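/- Let C be a bounded open convex subset of ℝ² with λ₁(C) > 0. Then C is strictly convex: for any two distinct points x, y of the boundary ∂C, the open segment joining x to y is contained in C. -/

import Mathlib

open MeasureTheory Set Filter
open scoped ENNReal NNReal

noncomputable section

/-- Euclidean `n`-space. -/
abbrev Euc (n : ℕ) : Type := EuclideanSpace ℝ (Fin n)

/-- The set of parameters `t` such that `p + t • v` lies in `C`. For `C` open bounded
convex, `p ∈ C` and `v ≠ 0` this is an open interval `(t⁻, t⁺)` with `t⁻ < 0 < t⁺`;
the points `p + t⁻ • v` and `p + t⁺ • v` are the two intersections of the boundary `∂C`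
with the line through `p` directed by `v`. -/
def lineParams {n : ℕ} (C : Set (Euc n)) (p v : Euc n) : Set ℝ := {t : ℝ | p + t • v ∈ C}

open Classical in
/-- The Hilbert distance of the convex set `C`: with `a = p + t⁻ • (q - p)` and
`b = p + t⁺ • (q - p)` the two boundary points (so that `a, p, q, b` are in this order),
the cross-ratio `(‖q-a‖ ‖p-b‖)/(‖p-a‖ ‖q-b‖)` equals `((1 - t⁻) t⁺)/((-t⁻)(t⁺ - 1))`. -/
def hDist {n : ℕ} (C : Set (Euc n)) (p q : Euc n) : ℝ :=
  if p = q then 0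
  else
    (1 / 2) * Real.log
      (((1 - sInf (lineParams C p (q - p))) * sSup (lineParams C p (q - p))) /
        ((-sInf (lineParams C p (q - p))) * (sSup (lineParams C p (q - p)) - 1)))

open Classical in
/-- The Hilbert Finsler norm of `u` at `p`: with `p⁺ = p + t⁺ • u`, `p⁻ = p + t⁻ • u`
the two boundary points on the line through `p` directed by `u`, one has
`(1/2)‖u‖(1/‖p-p⁺‖ + 1/‖p-p⁻‖) = (1/2)(1/t⁺ - 1/t⁻)`. -/
def fNorm {n : ℕ} (C : Set (Euc n)) (p u : Euc n) : ℝ :=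
  if u = 0 then 0
  else (1 / 2) * (1 / sSup (lineParams C p u) - 1 / sInf (lineParams C p u))

/-- The dual norm of a linear form `l` at `p`: `sup {l u : ‖u‖_{C,p} = 1}`. -/
def dualNorm {n : ℕ} (C : Set (Euc n)) (p : Euc n) (l : Euc n →L[ℝ] ℝ) : ℝ :=
  sSup ((fun u => l u) '' {u : Euc n | fNorm C p u = 1})

/-- The tangent ball `TB_R(p) = {u : ‖u‖_{C,p} < R}`. -/
def tangentBall {n : ℕ} (C : Set (Euc n)) (p : Euc n) (R : ℝ) : Set (Euc n) :=
  {u : Euc n | fNorm C p u < R}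

/-- `ωₙ`, the Lebesgue volume of the Euclidean unit ball of `ℝⁿ`. -/
def omegaVol (n : ℕ) : ℝ := (volume (Metric.ball (0 : Euc n) 1)).toReal

/-- The Hilbert (Busemann) measure of `C`: density `ωₙ / vol_e(TB_C(p))` against
Lebesgue measure, supported on `C`. -/
def hMeasure {n : ℕ} (C : Set (Euc n)) : Measure (Euc n) :=
  (volume.restrict C).withDensity fun p =>
    ENNReal.ofReal (omegaVol n / (volume (tangentBall C p 1)).toReal)

/-- Admissible test functions: nonzero Lipschitz functions with compact support
contained in `Ω`. -/
def testFuns {n : ℕ} (Ω : Set (Euc n)) : Set (Euc n → ℝ) :=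
  {f : Euc n → ℝ |
    (∃ K : ℝ≥0, LipschitzWith K f) ∧ f ≠ 0 ∧ HasCompactSupport f ∧ tsupport f ⊆ Ω}

/-- The Rayleigh quotient of `f` on `Ω`, with respect to the Hilbert geometry of `C`
(`df` is the a.e.-defined differential of the Lipschitz function `f`). -/
def rayleigh {n : ℕ} (C Ω : Set (Euc n)) (f : Euc n → ℝ) : ℝ :=
  (∫ p in Ω, dualNorm C p (fderiv ℝ f p) ^ 2 ∂hMeasure C) /
    ∫ p in Ω, f p ^ 2 ∂hMeasure C

/-- The Dirichlet bottom of the spectrum `λ₁^C(Ω)`. -/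
def lambda1D {n : ℕ} (C Ω : Set (Euc n)) : ℝ := sInf (rayleigh C Ω '' testFuns Ω)

/-- The bottom of the spectrum `λ₁(C)` of the Hilbert geometry of `C`. -/
def lambda1 {n : ℕ} (C : Set (Euc n)) : ℝ := lambda1D C C

/-- The Gromov product `(x|y)_t = (d(x,t) + d(y,t) - d(x,y))/2`. -/
def gromovProd {n : ℕ} (d : Euc n → Euc n → ℝ) (x y t : Euc n) : ℝ :=
  (d x t + d y t - d x y) / 2

/-- `(C, d_C)` is `δ`-hyperbolic: for all `x y z t` in `C`,
`(x|y)_t ≥ min((x|z)_t, (y|z)_t) - δ`. -/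
def IsDeltaHyp {n : ℕ} (C : Set (Euc n)) (δ : ℝ) : Prop :=
  ∀ x ∈ C, ∀ y ∈ C, ∀ z ∈ C, ∀ t ∈ C,
    gromovProd (hDist C) x y t ≥
      min (gromovProd (hDist C) x z t) (gromovProd (hDist C) y z t) - δ

/-- The metric ball `B_R(x)` of the Hilbert metric of `C`. -/
def hBall {n : ℕ} (C : Set (Euc n)) (x : Euc n) (R : ℝ) : Set (Euc n) :=
  {y ∈ C | hDist C x y < R}

/-- The image of `C` under the homothety of center `P₀` and ratio `r`. -/
def homoth {n : ℕ} (P₀ : Euc n) (r : ℝ) (C : Set (Euc n)) : Set (Euc n) :=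
  (fun x => P₀ + r • (x - P₀)) '' C

/-- Diameter of a set with respect to a distance function `d`. -/
def ediamD {α : Type*} (d : α → α → ℝ) (S : Set α) : ℝ≥0∞ :=
  ⨆ x ∈ S, ⨆ y ∈ S, ENNReal.ofReal (d x y)

/-- The `k`-dimensional Hausdorff measure of `S` with respect to the distance
function `d`. -/
def hausD {α : Type*} (k : ℝ) (d : α → α → ℝ) (S : Set α) : ℝ≥0∞ :=
  ⨆ (ε : ℝ≥0∞) (_ : 0 < ε),
    ⨅ (U : ℕ → Set α) (_ : S ⊆ ⋃ i, U i) (_ : ∀ i, ediamD d (U i) ≤ ε),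
      ∑' i, ediamD d (U i) ^ k

/-- The frontier of `U` is a rectifiable closed curve (for the Hilbert metric of `C`):
it is the image of a closed continuous curve and has finite one-dimensional Hausdorff
measure. -/
def RectCurveBoundary (C U : Set (Euc 2)) : Prop :=
  ∃ c : ℝ → Euc 2, ContinuousOn c (Icc 0 1) ∧ c '' Icc (0 : ℝ) 1 = frontier U ∧
    c 0 = c 1 ∧ hausD 1 (hDist C) (frontier U) < ⊤

/-- The Cheeger constant `I_∞^C(Ω)` in dimension `2`: infimum of
`ν_C(∂U)/μ_C(U)` over open sets `U` with closure contained in `Ω` whose boundary is a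
rectifiable curve, `ν_C` being the `1`-dimensional Hausdorff measure of `(C, d_C)`. -/
def cheeger2D (C Ω : Set (Euc 2)) : ℝ :=
  sInf {r : ℝ | ∃ U : Set (Euc 2), IsOpen U ∧ U.Nonempty ∧ closure U ⊆ Ω ∧
    RectCurveBoundary C U ∧
    r = (hausD 1 (hDist C) (frontier U)).toReal / (hMeasure C U).toReal}

/-- The Cheeger constant `I_∞(C)` of a planar Hilbert geometry. -/
def cheeger2 (C : Set (Euc 2)) : ℝ := cheeger2D C C

/-- `S` is a `C¹` hypersurface: near each of its points it is the zero set of a `C¹`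
function with nonvanishing differential. -/
def IsC1Hypersurface {n : ℕ} (S : Set (Euc n)) : Prop :=
  ∀ x ∈ S, ∃ (f : Euc n → ℝ) (U : Set (Euc n)), U ∈ nhds x ∧ ContDiffOn ℝ 1 f U ∧
    (∀ y ∈ U, fderiv ℝ f y ≠ 0) ∧ S ∩ U = {y ∈ U | f y = 0}

/-- The Cheeger constant `I_∞^C(Ω)` in dimension `n`: infimum of `ν_C(∂U)/μ_C(U)` over
open sets `U` with closure contained in `Ω` whose boundary is a `C¹` hypersurface,
`ν_C` being the `(n-1)`-dimensional Hausdorff measure of `(C, d_C)`. -/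
def cheegerND {n : ℕ} (C Ω : Set (Euc n)) : ℝ :=
  sInf {r : ℝ | ∃ U : Set (Euc n), IsOpen U ∧ U.Nonempty ∧ closure U ⊆ Ω ∧
    IsC1Hypersurface (frontier U) ∧
    r = (hausD ((n : ℝ) - 1) (hDist C) (frontier U)).toReal / (hMeasure C U).toReal}

/-- The boundary of the convex set `C` is of class `C¹`: through each boundary point
passes a unique supporting hyperplane. -/
def HasC1Boundary {n : ℕ} (C : Set (Euc n)) : Prop :=
  ∀ x ∈ frontier C, ∃! l : Euc n →L[ℝ] ℝ, ‖l‖ = 1 ∧ ∀ y ∈ C, l y ≤ l x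

/-- The convex set `C` is strictly convex: the open segment joining two distinct
boundary points is contained in `C`. -/
def IsStrictlyConvexSet {n : ℕ} (C : Set (Euc n)) : Prop :=
  ∀ x ∈ frontier C, ∀ y ∈ frontier C, x ≠ y → openSegment ℝ x y ⊆ C

end

lemma lp_zero_nhds {C : Set (Euc 2)} (hopen : IsOpen C) {p : Euc 2} (hp : p ∈ C) (u : Euc 2) :
    ∃ e > 0, ∀ t : ℝ, |t| < e → t ∈ lineParams C p u := by
  have hc : Continuous (fun t : ℝ => p + t • u) := by fun_prop
  have ho : IsOpen (lineParams C p u) := hopen.preimage hc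
  have h0 : (0 : ℝ) ∈ lineParams C p u := by simpa [lineParams] using hp
  obtain ⟨e, he, h⟩ := Metric.isOpen_iff.1 ho 0 h0
  refine ⟨e, he, fun t ht => h ?_⟩
  simpa [Metric.mem_ball, Real.dist_eq] using ht

lemma one_div_sSup_nonneg {S : Set ℝ} (h0 : (0 : ℝ) ∈ S) : 0 ≤ 1 / sSup S :=
  one_div_nonneg.2 (Real.sSup_nonneg' ⟨0, h0, le_rfl⟩)

lemma one_div_sInf_nonpos {S : Set ℝ} (h0 : (0 : ℝ) ∈ S) : 1 / sInf S ≤ 0 :=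
  one_div_nonpos.2 (Real.sInf_nonpos' ⟨0, h0, le_rfl⟩)

lemma fNorm_lower {C : Set (Euc 2)} (hopen : IsOpen C) {p : Euc 2} (hp : p ∈ C) (u : Euc 2)
    (hu : u ≠ 0) (A k : ℝ) (hA : 0 < A) (h : ∀ t ∈ lineParams C p u, 0 < A + t * k) :
    |k| / (2 * A) ≤ fNorm C p u := by
  obtain ⟨e, he, hin⟩ := lp_zero_nhds hopen hp u
  have h0 : (0 : ℝ) ∈ lineParams C p u := hin 0 (by simpa using he)
  have hs := one_div_sSup_nonneg h0
  have hi := one_div_sInf_nonpos h0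
  rw [fNorm, if_neg hu]
  have e1 : |k| / (2 * A) = (1/2) * (|k| / A) := by field_simp
  rw [e1]
  refine mul_le_mul_of_nonneg_left ?_ (by norm_num)
  rcases lt_trichotomy k 0 with hk | hk | hk
  · have hb : ∀ t ∈ lineParams C p u, t ≤ A / (-k) := by
      intro t ht
      rw [le_div_iff₀ (by linarith)]
      have := h t ht
      linarith
    have hle : sSup (lineParams C p u) ≤ A / (-k) := csSup_le ⟨0, h0⟩ hb
    have hpos : 0 < sSup (lineParams C p u) := by
      have := le_csSup ⟨_, hb⟩ (hin (e/2) (by rw [abs_of_pos (by linarith)]; linarith))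
      linarith
    have := one_div_le_one_div_of_le hpos hle
    rw [abs_of_neg hk]
    have e2 : 1 / (A / (-k)) = (-k) / A := by rw [one_div_div]
    linarith
  · subst hk; simp only [abs_zero, zero_div]; linarith
  · have hb : ∀ t ∈ lineParams C p u, -(A / k) ≤ t := by
      intro t ht
      rw [neg_le, le_div_iff₀ hk]
      have := h t ht
      linarith
    have hle : -(A / k) ≤ sInf (lineParams C p u) := le_csInf ⟨0, h0⟩ hb
    have hneg : sInf (lineParams C p u) < 0 := by
      have := csInf_le ⟨_, hb⟩ (hin (-(e/2)) (by rw [abs_neg, abs_of_pos (by linarith)]; linarith))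
      linarith
    have := one_div_le_one_div_of_le (a := - sInf (lineParams C p u)) (by linarith)
      (show - sInf (lineParams C p u) ≤ A / k by linarith)
    rw [abs_of_pos hk]
    have e2 : 1 / (A / k) = k / A := by rw [one_div_div]
    have e3 : 1 / (- sInf (lineParams C p u)) = - (1 / sInf (lineParams C p u)) := by
      rw [div_neg]
    linarith

lemma fNorm_upper {C : Set (Euc 2)} {p : Euc 2} (u : Euc 2) (r : ℝ) (hr : 0 < r)
    (h : ∀ t : ℝ, |t| < r → t ∈ lineParams C p u) : fNorm C p u ≤ 1 / r := by
  rw [fNorm]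
  split_ifs with hu
  · positivity
  have a1 : 1 / sSup (lineParams C p u) ≤ 1 / r := by
    by_cases hb : BddAbove (lineParams C p u)
    · apply one_div_le_one_div_of_le hr
      refine le_of_forall_lt_imp_le_of_dense ?_ |>.trans le_rfl
      intro t ht
      by_cases h0 : 0 ≤ t
      · exact le_csSup hb (h t (by rwa [abs_of_nonneg h0]))
      · exact le_trans (not_le.1 h0).le (le_csSup hb (h 0 (by simpa using hr)))
    · rw [Real.sSup_of_not_bddAbove hb]; simp [hr.le]
  have a2 : - (1 / sInf (lineParams C p u)) ≤ 1 / r := by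
    by_cases hb : BddBelow (lineParams C p u)
    · rw [← div_neg]
      apply one_div_le_one_div_of_le hr
      refine le_of_forall_lt_imp_le_of_dense ?_ |>.trans le_rfl
      intro t ht
      by_cases h0 : 0 ≤ t
      · have := csInf_le hb (h (-t) (by rwa [abs_neg, abs_of_nonneg h0]))
        linarith
      · have := (csInf_le hb (h 0 (by simpa using hr)))
        linarith
    · rw [Real.sInf_of_not_bddBelow hb]; simp [hr.le]
  linarith

section geom
variable {C : Set (Euc 2)} {B : Euc 2} {L : (ℝ × ℝ) ≃L[ℝ] Euc 2}

lemma fN_up (h2 : ∀ x : ℝ × ℝ, 0 < x.1 → 0 < x.2 → x.1 + x.2 ≤ 1 → B + L x ∈ C)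
    (x : ℝ × ℝ) (hx1 : 0 < x.1) (hx1' : x.1 ≤ 1/4) (hx2 : 0 < x.2) (hx2' : x.2 ≤ 1/4)
    (u : ℝ × ℝ) (h1 : |u.1| < x.1 / 2) (h1' : |u.2| < x.2 / 2) :
    fNorm C (B + L x) (L u) < 1 := by
  -- choose r slightly more than one
  obtain ⟨r, hr1, hra, hrb⟩ : ∃ r : ℝ, 1 < r ∧ r * |u.1| < x.1 ∧ r * |u.2| < x.2 :=
    ⟨2, by norm_num, by linarith, by linarith⟩
  refine lt_of_le_of_lt (fNorm_upper (L u) r (by linarith) ?_) ?_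
  · intro t ht
    have e : B + L x + t • L u = B + L (x + t • u) := by simp [add_assoc]
    show B + L x + t • L u ∈ C
    rw [e]
    have b1 : |t * u.1| < x.1 := by
      rw [abs_mul]
      exact lt_of_le_of_lt (mul_le_mul_of_nonneg_right ht.le (abs_nonneg _)) hra
    have b2 : |t * u.2| < x.2 := by
      rw [abs_mul]
      exact lt_of_le_of_lt (mul_le_mul_of_nonneg_right ht.le (abs_nonneg _)) hrb
    rw [abs_lt] at b1 b2
    apply h2 <;> simp <;> linarith
  · rw [div_lt_one (by linarith)]; exact hr1

lemma fN_low2 (hopen : IsOpen C) (h1 : ∀ x : ℝ × ℝ, B + L x ∈ C → 0 < x.2)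
    (x : ℝ × ℝ) (hx : B + L x ∈ C) (u : ℝ × ℝ) (hu : fNorm C (B + L x) (L u) ≤ 1) :
    |u.2| ≤ 2 * x.2 := by
  have hx2 := h1 x hx
  by_cases h0 : L u = 0
  · have : u = 0 := by simpa using h0
    subst this; simp; linarith
  have := fNorm_lower hopen hx (L u) h0 x.2 u.2 hx2 (by
    intro t ht
    have e : B + L x + t • L u = B + L (x + t • u) := by simp [add_assoc]
    change B + L x + t • L u ∈ C at ht
    rw [e] at ht
    simpa using h1 _ ht)
  have h := this.trans hu
  rwa [div_le_one (by linarith)] at h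

lemma fN_low1 (hopen : IsOpen C) (h1 : ∀ x : ℝ × ℝ, B + L x ∈ C → 0 < x.2)
    (a M : ℝ) (hM : 0 ≤ M) 
    (h3 : ∀ x : ℝ × ℝ, B + L x ∈ C → 0 < x.1 + M * x.2 + a)
    (x : ℝ × ℝ) (hx : B + L x ∈ C) (hxa : a ≤ x.1) (hx0 : 0 < x.1) (hxM : M * x.2 ≤ x.1)
    (u : ℝ × ℝ) (hu : fNorm C (B + L x) (L u) ≤ 1) :
    |u.1| ≤ 8 * x.1 := by
  have hx2 := h1 x hx
  have hu2 := fN_low2 hopen h1 x hx u hu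
  by_cases h0 : L u = 0
  · have : u = 0 := by simpa using h0
    subst this; simp; linarith
  have := fNorm_lower hopen hx (L u) h0 (x.1 + M * x.2 + a) (u.1 + M * u.2) (h3 x hx) (by
    intro t ht
    have e : B + L x + t • L u = B + L (x + t • u) := by simp [add_assoc]
    change B + L x + t • L u ∈ C at ht
    rw [e] at ht
    have := h3 _ ht
    simp at this
    linarith)
  have h := this.trans hu
  rw [div_le_one (by linarith [h3 x hx])] at h
  have h4 : |u.1| ≤ |u.1 + M * u.2| + M * |u.2| := by
    calc |u.1| = |(u.1 + M * u.2) - M * u.2| := by ring_nf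
      _ ≤ |u.1 + M * u.2| + |M * u.2| := abs_sub _ _
      _ = _ := by rw [abs_mul, abs_of_nonneg hM]
  have h5 : M * |u.2| ≤ M * (2 * x.2) := mul_le_mul_of_nonneg_left hu2 hM
  linarith
end geom

/-- Adapted coordinates. -/
lemma exists_coords (C : Set (Euc 2)) (hconv : Convex ℝ C) (hopen : IsOpen C)
    (hbdd : Bornology.IsBounded C) (hne : C.Nonempty) (x y z : Euc 2) (hx : x ∈ frontier C)
    (hy : y ∈ frontier C) (hxy : x ≠ y) (hz : z ∈ openSegment ℝ x y) (hzC : z ∉ C) :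
    ∃ (B : Euc 2) (L : (ℝ × ℝ) ≃L[ℝ] Euc 2),
      (∀ x : ℝ × ℝ, B + L x ∈ C → 0 < x.2) ∧
      (∀ x : ℝ × ℝ, 0 < x.1 → 0 < x.2 → x.1 + x.2 ≤ 1 → B + L x ∈ C) ∧
      (∀ a > 0, ∃ M ≥ 0, ∀ x : ℝ × ℝ, B + L x ∈ C → 0 < x.1 + M * x.2 + a) := by
  obtain ⟨f, hf⟩ := geometric_hahn_banach_point_open hconv hopen hzC
  have hxc : x ∈ closure C := frontier_subset_closure hx
  have hyc : y ∈ closure C := frontier_subset_closure hy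
  have hfc : ∀ b ∈ closure C, f z ≤ f b := by
    intro b hb
    have : closure C ⊆ {b | f z ≤ f b} :=
      closure_minimal (fun b hb => (hf b hb).le) (isClosed_le continuous_const f.continuous)
    exact this hb
  obtain ⟨α, β, hα, hβ, hαβ, rfl⟩ := hz
  have e1 : f x = f y := by
    have h1 := hfc x hxc
    have h2 := hfc y hyc
    simp only [map_add, map_smul, smul_eq_mul] at h1 h2
    obtain rfl : α = 1 - β := by linarith
    apply le_antisymm <;> by_contra hlt <;> push Not at hlt <;> nlinarith
  have ez : f (α • x + β • y) = f y := by
    simp only [map_add, map_smul, smul_eq_mul, e1]; rw [← add_mul, hαβ, one_mul]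
  rw [ez] at hf hfc
  -- leftmost point
  set S : Set ℝ := {t : ℝ | x + t • (y - x) ∈ closure C} with hS
  have hScl : IsClosed S := isClosed_closure.preimage (by fun_prop)
  have hd : 0 < ‖y - x‖ := norm_pos_iff.2 (sub_ne_zero.2 hxy.symm)
  have hSb : BddBelow S := by
    obtain ⟨R, hR⟩ := hbdd.closure.exists_norm_le
    refine ⟨-((R + ‖x‖) / ‖y - x‖), fun t ht => ?_⟩
    have h1 := hR _ ht
    have h2 : ‖t • (y - x)‖ ≤ R + ‖x‖ := by
      calc ‖t • (y - x)‖ = ‖(x + t • (y - x)) - x‖ := by simp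
        _ ≤ ‖x + t • (y - x)‖ + ‖x‖ := norm_sub_le _ _
        _ ≤ _ := by linarith
    rw [norm_smul, Real.norm_eq_abs, ← le_div_iff₀ hd] at h2
    exact (abs_le.1 h2).1
  have h0S : (0 : ℝ) ∈ S := by simpa [hS] using hxc
  have htS : sInf S ∈ S := hScl.csInf_mem ⟨0, h0S⟩ hSb
  set t0 := sInf S with ht0
  have ht0' : t0 ≤ 0 := csInf_le hSb h0S
  set B : Euc 2 := x + t0 • (y - x) with hB
  have hBc : B ∈ closure C := htS
  have hye : y - B = (1 - t0) • (y - x) := by rw [hB]; module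
  have hfB : f B = f y := by simp [hB, e1]
  obtain ⟨Q, hQ⟩ := hne
  have hfQ := hf Q hQ
  let L0 : (ℝ × ℝ) →ₗ[ℝ] Euc 2 :=
    (LinearMap.toSpanSingleton ℝ (Euc 2) (y - B)).coprod (LinearMap.toSpanSingleton ℝ (Euc 2) (Q - B))
  have hL0 : ∀ v, L0 v = v.1 • (y - B) + v.2 • (Q - B) := fun v => by simp [L0]
  have hfL : ∀ v, f (L0 v) = v.2 * (f Q - f y) := by
    intro v; rw [hL0]; simp [hfB]
  have hinj : Function.Injective L0 := by
    rw [injective_iff_map_eq_zero]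
    intro v hv
    have h2 := hfL v
    rw [hv, map_zero] at h2
    have h2' : v.2 = 0 := by
      rcases mul_eq_zero.1 h2.symm with h | h
      · exact h
      · linarith
    rw [hL0, h2', zero_smul, add_zero, hye, smul_smul] at hv
    have h3 : v.1 * (1 - t0) = 0 := by
      rcases smul_eq_zero.1 hv with h | h
      · exact h
      · exact absurd (sub_eq_zero.1 h).symm hxy
    have h1' : v.1 = 0 := by
      rcases mul_eq_zero.1 h3 with h | h
      · exact h
      · linarith
    exact Prod.ext h1' h2'
  let L1 : (ℝ × ℝ) ≃ₗ[ℝ] Euc 2 := LinearEquiv.ofInjectiveOfFinrankEq L0 hinj (by simp)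
  let L : (ℝ × ℝ) ≃L[ℝ] Euc 2 := L1.toContinuousLinearEquiv
  have hLL : ∀ v, L v = L0 v := fun v => rfl
  have hp1 : ∀ v : ℝ × ℝ, B + L v ∈ C → 0 < v.2 := by
    intro v hv
    have := hf _ hv
    rw [map_add, hLL, hfL, hfB] at this
    by_contra hc
    nlinarith
  refine ⟨B, L, hp1, ?_, ?_⟩
  · intro v hv1 hv2 hv
    have hlt : v.2 < 1 := by linarith
    -- the base point
    set k := v.1 / (1 - v.2) with hk
    have hk0 : 0 ≤ k := div_nonneg hv1.le (by linarith)
    have hk1 : k ≤ 1 := by rw [hk, div_le_one (by linarith)]; linarith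
    have hbase : (1 - k) • B + k • y ∈ closure C :=
      hconv.closure hBc hyc (by linarith) hk0 (by ring)
    have hQi : Q ∈ interior C := by rwa [hopen.interior_eq]
    have := hconv.combo_interior_closure_mem_interior hQi hbase hv2 (b := 1 - v.2) (by linarith)
      (by ring)
    rw [hopen.interior_eq] at this
    convert this using 1
    rw [hLL, hL0]
    have hv1' : v.1 = (1 - v.2) * k := by
      rw [hk, mul_div_cancel₀]; linarith
    rw [hv1']
    module
  · intro a ha
    have hnot : B - a • (y - B) ∉ closure C := by
      intro hmem
      have : t0 - a * (1 - t0) ∈ S := by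
        show x + (t0 - a * (1 - t0)) • (y - x) ∈ closure C
        convert hmem using 1
        rw [hye, hB]; module
      have := csInf_le hSb this
      nlinarith
    obtain ⟨g, w, hg1, hg2⟩ := geometric_hahn_banach_point_closed hconv.closure isClosed_closure hnot
    have hgB := hg2 B hBc
    simp only [map_sub, map_smul, smul_eq_mul] at hg1
    set A := g y - g B with hA
    have hApos : 0 < A := by
      by_contra hc; push Not at hc
      nlinarith
    refine ⟨|(g Q - g B) / A|, abs_nonneg _, fun v hv => ?_⟩
    have hv2 := hp1 v hv
    have := hg2 _ (subset_closure hv)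
    rw [map_add, hLL, hL0] at this
    simp only [map_add, map_sub, map_smul, smul_eq_mul] at this
    rw [← hA] at this
    have h5 : 0 < v.1 * A + v.2 * (g Q - g B) + a * A := by linarith
    have h6 : 0 < v.1 + (g Q - g B) / A * v.2 + a := by
      have e : v.1 + (g Q - g B) / A * v.2 + a = (v.1 * A + v.2 * (g Q - g B) + a * A) / A := by
        field_simp
      rw [e]; positivity
    have h7 : (g Q - g B) / A * v.2 ≤ |(g Q - g B) / A| * v.2 :=
      mul_le_mul_of_nonneg_right (le_abs_self _) hv2.le
    linarith

lemma vol_scale (L : (ℝ × ℝ) ≃L[ℝ] Euc 2) (B : Euc 2) : ∃ c : ℝ≥0, 0 < c ∧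
    (volume : Measure (Euc 2)) = c • Measure.map (fun x => L x) (volume : Measure (ℝ × ℝ)) ∧
    (volume : Measure (Euc 2)) = c • Measure.map (fun x => B + L x) (volume : Measure (ℝ × ℝ)) := by
  have : (Measure.map (fun x => L x) (volume : Measure (ℝ × ℝ))).IsAddHaarMeasure :=
    L.isAddHaarMeasure_map volume
  have h1 := Measure.isAddLeftInvariant_eq_smul (volume : Measure (Euc 2))
    (Measure.map (fun x => L x) (volume : Measure (ℝ × ℝ)))
  refine ⟨_, Measure.addHaarScalarFactor_pos_of_isAddHaarMeasure (volume : Measure (Euc 2))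
    (Measure.map (fun x => L x) (volume : Measure (ℝ × ℝ))), h1, ?_⟩
  have h2 : Measure.map (fun x => B + L x) (volume : Measure (ℝ × ℝ)) =
      Measure.map (fun x => L x) (volume : Measure (ℝ × ℝ)) := by
    have e : (fun x => B + L x) = (fun v => B + v) ∘ (fun x => L x) := rfl
    rw [e, ← Measure.map_map (by fun_prop) (L.continuous.measurable), map_add_left_eq_self]
  rw [h2]; exact h1

lemma emb (L : (ℝ × ℝ) ≃L[ℝ] Euc 2) (B : Euc 2) : MeasurableEmbedding (fun x => B + L x) :=
  (L.toHomeomorph.trans (Homeomorph.addLeft B)).measurableEmbedding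

noncomputable def dens (C : Set (Euc 2)) (p : Euc 2) : ℝ≥0∞ :=
  ENNReal.ofReal (omegaVol 2 / (volume (tangentBall C p 1)).toReal)

lemma hMeasure_image (C : Set (Euc 2)) (L : (ℝ × ℝ) ≃L[ℝ] Euc 2) (B : Euc 2) (c : ℝ≥0)
    (hc : (volume : Measure (Euc 2)) = c • Measure.map (fun x => B + L x) (volume : Measure (ℝ × ℝ)))
    (E : Set (ℝ × ℝ)) (hE : MeasurableSet E) (hEC : ∀ x ∈ E, B + L x ∈ C) :
    hMeasure C ((fun x => B + L x) '' E) = c * ∫⁻ x in E, dens C (B + L x) := by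
  have hm : MeasurableSet ((fun x => B + L x) '' E) := (emb L B).measurableSet_image.2 hE
  have hsub : ((fun x => B + L x) '' E) ∩ C = (fun x => B + L x) '' E := by
    apply inter_eq_left.2
    rintro _ ⟨x, hx, rfl⟩
    exact hEC x hx
  rw [hMeasure, withDensity_apply _ hm, Measure.restrict_restrict hm, hsub]
  have h3 : (volume : Measure (Euc 2)).restrict ((fun x => B + L x) '' E) =
      c • Measure.map (fun x => B + L x) ((volume : Measure (ℝ × ℝ)).restrict E) := by
    conv_lhs => rw [hc]
    rw [Measure.restrict_smul, (emb L B).restrict_map,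
      preimage_image_eq _ (emb L B).injective]
  rw [h3, lintegral_smul_measure, (emb L B).lintegral_map]
  rfl

lemma lint_inv (a b : ℝ) (ha : 0 < a) (hab : a ≤ b) :
    ∫⁻ x in Icc a b, ENNReal.ofReal (x⁻¹) = ENNReal.ofReal (Real.log (b / a)) := by
  have hcont : ContinuousOn (fun x : ℝ => x⁻¹) (Icc a b) :=
    continuousOn_inv₀.mono (fun x hx => by
      have := hx.1; simp; linarith)
  rw [← integral_inv_of_pos ha (by linarith), intervalIntegral.integral_of_le hab,
    ← integral_Icc_eq_integral_Ioc]
  rw [ofReal_integral_eq_lintegral_ofReal hcont.integrableOn_Icc]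
  refine (ae_restrict_iff' measurableSet_Icc).2 (Eventually.of_forall fun x hx => ?_)
  have := hx.1
  exact inv_nonneg.2 (by linarith)

lemma lint_box (K a b a' b' : ℝ) (hK : 0 ≤ K) (ha : 0 < a) (hab : a ≤ b) (ha' : 0 < a') (hab' : a' ≤ b') :
    ∫⁻ x in Icc a b ×ˢ Icc a' b', ENNReal.ofReal (K / (x.1 * x.2)) =
      ENNReal.ofReal (K * (Real.log (b / a) * Real.log (b' / a'))) := by
  have h1 : ∫⁻ x in Icc a b ×ˢ Icc a' b', ENNReal.ofReal (K / (x.1 * x.2)) =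
      ∫⁻ x in Icc a b ×ˢ Icc a' b', ENNReal.ofReal K *
        (ENNReal.ofReal (x.1⁻¹) * ENNReal.ofReal (x.2⁻¹)) := by
    refine setLIntegral_congr_fun (measurableSet_Icc.prod measurableSet_Icc) ?_
    rintro ⟨s, h⟩ ⟨hs, hh⟩
    have := hs.1; have := hh.1
    dsimp only
    have i1 : 0 ≤ s⁻¹ := inv_nonneg.2 (by linarith [hs.1])
    rw [← ENNReal.ofReal_mul i1, ← ENNReal.ofReal_mul hK, div_eq_mul_inv, mul_inv]
  have hlog : 0 ≤ Real.log (b / a) := Real.log_nonneg (by rw [le_div_iff₀ ha]; linarith)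
  rw [h1, lintegral_const_mul _ (by fun_prop), Measure.volume_eq_prod, ← Measure.prod_restrict,
    lintegral_prod_mul (f := fun s : ℝ => ENNReal.ofReal s⁻¹) (g := fun s : ℝ => ENNReal.ofReal s⁻¹)
      (by fun_prop) (by fun_prop), lint_inv a b ha hab, lint_inv a' b' ha' hab',
    ← ENNReal.ofReal_mul hlog, ← ENNReal.ofReal_mul hK]

/-- Two sided bounds on the volume of the tangent ball. -/
lemma tb_bounds {C : Set (Euc 2)} {L : (ℝ × ℝ) ≃L[ℝ] Euc 2} (c : ℝ≥0) (p : Euc 2) (s h : ℝ)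
    (hs : 0 < s) (hh : 0 < h)
    (hc : (volume : Measure (Euc 2)) = c • Measure.map (fun x => L x) (volume : Measure (ℝ × ℝ)))
    (hin : ∀ u : ℝ × ℝ, |u.1| < s / 2 → |u.2| < h / 2 → fNorm C p (L u) < 1)
    (hout : ∀ u : ℝ × ℝ, fNorm C p (L u) ≤ 1 → |u.1| ≤ 8 * s ∧ |u.2| ≤ 2 * h) :
    (c : ℝ) * (s * h) ≤ (volume (tangentBall C p 1)).toReal ∧
    (volume (tangentBall C p 1)).toReal ≤ 64 * ((c : ℝ) * (s * h)) := by
  have hemb : MeasurableEmbedding (fun x => L x) := L.toHomeomorph.measurableEmbedding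
  have hv : volume (tangentBall C p 1) = c * volume ((fun x => L x) ⁻¹' tangentBall C p 1) := by
    rw [hc, Measure.smul_apply, hemb.map_apply, ENNReal.smul_def, smul_eq_mul]
  have hlow : ENNReal.ofReal (s * h) ≤ volume ((fun x => L x) ⁻¹' tangentBall C p 1) := by
    have hsub : Ioo (-(s/2)) (s/2) ×ˢ Ioo (-(h/2)) (h/2) ⊆ (fun x => L x) ⁻¹' tangentBall C p 1 := by
      rintro u ⟨h1, h2⟩
      exact hin u (abs_lt.2 h1) (abs_lt.2 h2)
    refine le_trans (le_of_eq ?_) (measure_mono hsub)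
    rw [Measure.volume_eq_prod, Measure.prod_prod, Real.volume_Ioo, Real.volume_Ioo,
      ← ENNReal.ofReal_mul (by linarith)]
    congr 1; ring
  have hup : volume ((fun x => L x) ⁻¹' tangentBall C p 1) ≤ ENNReal.ofReal (64 * (s * h)) := by
    have hsub : (fun x => L x) ⁻¹' tangentBall C p 1 ⊆
        Icc (-(8*s)) (8*s) ×ˢ Icc (-(2*h)) (2*h) := by
      intro u hu
      obtain ⟨h1, h2⟩ := hout u (le_of_lt hu)
      exact ⟨abs_le.1 h1, abs_le.1 h2⟩
    refine le_trans (measure_mono hsub) (le_of_eq ?_)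
    rw [Measure.volume_eq_prod, Measure.prod_prod, Real.volume_Icc, Real.volume_Icc,
      ← ENNReal.ofReal_mul (by linarith)]
    congr 1; ring
  rw [hv, ENNReal.toReal_mul, ENNReal.coe_toReal]
  constructor
  · refine mul_le_mul_of_nonneg_left ?_ c.2
    exact (ENNReal.ofReal_le_iff_le_toReal (ne_top_of_le_ne_top ENNReal.ofReal_ne_top hup)).1 hlow
  · have := ENNReal.toReal_le_of_le_ofReal (by positivity) hup
    calc (c:ℝ) * _ ≤ c * (64 * (s * h)) := mul_le_mul_of_nonneg_left this c.2
      _ = _ := by ring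

lemma omega_pos : 0 < omegaVol 2 := by
  rw [omegaVol]
  exact ENNReal.toReal_pos (Metric.measure_ball_pos volume _ one_pos).ne' measure_ball_lt_top.ne

noncomputable def eta (φ : ℝ → ℝ) (m R s : ℝ) : ℝ := if 0 < s then φ ((Real.log s - m) / R) else 0

section eta
variable {φ : ℝ → ℝ} {m R : ℝ}

lemma eta_eq_zero (hR : 0 < R) (hφ : ∀ x, 1 ≤ |x| → φ x = 0) {s : ℝ}
    (hs : s ∉ Ioo (Real.exp (m - R)) (Real.exp (m + R))) : eta φ m R s = 0 := by
  rw [eta]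
  split_ifs with h0
  · apply hφ
    by_contra hc
    push Not at hc
    rw [abs_div, abs_of_pos hR, div_lt_one hR, abs_lt] at hc
    apply hs
    constructor
    · rw [← Real.lt_log_iff_exp_lt h0]; linarith
    · rw [← Real.log_lt_iff_lt_exp h0]; linarith
  · rfl

lemma eta_contDiff (hR : 0 < R) (hφ : ∀ x, 1 ≤ |x| → φ x = 0) (hs : ContDiff ℝ 1 φ) :
    ContDiff ℝ 1 (eta φ m R) := by
  rw [contDiff_iff_contDiffAt]
  intro s
  by_cases h : 0 < s
  · have e : eta φ m R =ᶠ[nhds s] fun s => φ ((Real.log s - m) / R) := by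
      filter_upwards [lt_mem_nhds h] with t ht
      rw [eta, if_pos ht]
    refine ContDiffAt.congr_of_eventuallyEq ?_ e
    have : ContDiffAt ℝ 1 (fun s => (Real.log s - m) / R) s :=
      ((Real.contDiffAt_log.2 h.ne').sub contDiffAt_const).div_const _
    exact hs.contDiffAt.comp s this
  · have e : eta φ m R =ᶠ[nhds s] fun _ => 0 := by
      have : s < Real.exp (m - R) := lt_of_le_of_lt (not_lt.1 h) (Real.exp_pos _)
      filter_upwards [gt_mem_nhds this] with t ht
      exact eta_eq_zero hR hφ (fun hh => absurd hh.1 (not_lt.2 ht.le))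
    exact contDiffAt_const.congr_of_eventuallyEq e

lemma eta_deriv (hs : ContDiff ℝ 1 φ) {K : ℝ} (hK : ∀ x, |deriv φ x| ≤ K) (hR : 0 < R)
    {s : ℝ} (h : 0 < s) : |deriv (eta φ m R) s| ≤ K / (R * s) := by
  have e : eta φ m R =ᶠ[nhds s] fun s => φ ((Real.log s - m) / R) := by
    filter_upwards [lt_mem_nhds h] with t ht
    rw [eta, if_pos ht]
  rw [e.deriv_eq]
  have h1 : HasDerivAt (fun s => (Real.log s - m) / R) (s⁻¹ / R) s :=
    ((Real.hasDerivAt_log h.ne').sub_const m).div_const R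
  have h2 : HasDerivAt φ (deriv φ ((Real.log s - m) / R)) ((Real.log s - m) / R) :=
    (hs.differentiable (by norm_num) _).hasDerivAt
  have h3 := (h2.comp s h1).deriv
  simp only [Function.comp_def] at h3
  rw [h3, abs_mul, abs_of_nonneg (a := s⁻¹ / R) (by positivity)]
  calc _ ≤ K * (s⁻¹ / R) := mul_le_mul_of_nonneg_right (hK _) (by positivity)
    _ = _ := by field_simp

lemma eta_one (hR : 0 < R) (hφ : ∀ x, |x| ≤ 1/2 → φ x = 1) {s : ℝ}
    (hs : s ∈ Icc (Real.exp (m - R/2)) (Real.exp (m + R/2))) : eta φ m R s = 1 := by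
  have h0 : 0 < s := lt_of_lt_of_le (Real.exp_pos _) hs.1
  rw [eta, if_pos h0]
  apply hφ
  rw [abs_div, abs_of_pos hR, div_le_iff₀ hR, abs_le]
  have h1 := (Real.le_log_iff_exp_le h0).2 hs.1
  have h2 := (Real.log_le_iff_le_exp h0).2 hs.2
  constructor <;> linarith

lemma eta_abs_le (hφ : ∀ x, |φ x| ≤ 1) (s : ℝ) : |eta φ m R s| ≤ 1 := by
  rw [eta]; split_ifs
  · exact hφ _
  · simp
end eta

lemma exists_phi : ∃ (φ : ℝ → ℝ) (K : ℝ), ContDiff ℝ 1 φ ∧ (∀ x, 1 ≤ |x| → φ x = 0) ∧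
    (∀ x, |x| ≤ 1/2 → φ x = 1) ∧ (∀ x, |φ x| ≤ 1) ∧ (∀ x, |deriv φ x| ≤ K) ∧ 0 ≤ K := by
  let b : ContDiffBump (0 : ℝ) := ⟨1/2, 1, by norm_num, by norm_num⟩
  have hb : ContDiff ℝ 1 b := b.contDiff
  obtain ⟨K, hK⟩ := (b.hasCompactSupport.deriv).exists_bound_of_continuous
    (hb.continuous_deriv le_rfl)
  refine ⟨b, K, hb, ?_, ?_, ?_, hK, le_trans (norm_nonneg _) (hK 0)⟩
  · intro x hx
    exact b.zero_of_le_dist (by simpa [Real.dist_eq] using hx)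
  · intro x hx
    exact b.one_of_mem_closedBall (by simpa [Real.dist_eq, b] using hx)
  · intro x
    rw [abs_of_nonneg b.nonneg]; exact b.le_one

lemma dualNorm_abs_le {C : Set (Euc 2)} {p : Euc 2} {l : Euc 2 →L[ℝ] ℝ} {b : ℝ} (hb : 0 ≤ b)
    (h : ∀ u, fNorm C p u = 1 → |l u| ≤ b) : |dualNorm C p l| ≤ b := by
  rw [dualNorm]
  have hup : ∀ r ∈ (fun u => l u) '' {u : Euc 2 | fNorm C p u = 1}, r ≤ b := by
    rintro _ ⟨u, hu, rfl⟩
    exact (abs_le.1 (h u hu)).2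
  rw [abs_le]
  refine ⟨?_, Real.sSup_le hup hb⟩
  rcases eq_empty_or_nonempty {u : Euc 2 | fNorm C p u = 1} with he | ⟨u, hu⟩
  · rw [he]; simp [hb]
  · exact le_trans (abs_le.1 (h u hu)).1 (le_csSup ⟨b, hup⟩ ⟨u, hu, rfl⟩)

lemma rayleigh_nonneg (C : Set (Euc 2)) (f : Euc 2 → ℝ) : 0 ≤ rayleigh C C f :=
  div_nonneg (integral_nonneg fun _ => sq_nonneg _) (integral_nonneg fun _ => sq_nonneg _)

lemma rayleigh_le (C : Set (Euc 2)) (hC : IsOpen C) (f : Euc 2 → ℝ) (hfc : Continuous f)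
    (O I : Set (Euc 2)) (hO : MeasurableSet O) (hI : MeasurableSet I) (hsubset : I ⊆ O) (hOC : O ⊆ C)
    (b : ℝ) (hb : 0 ≤ b)
    (hd : ∀ p ∈ O, |dualNorm C p (fderiv ℝ f p)| ≤ b)
    (hd0 : ∀ p ∉ O, dualNorm C p (fderiv ℝ f p) = 0)
    (hf0 : ∀ p ∉ O, f p = 0) (hf1 : ∀ p, |f p| ≤ 1) (hfI : ∀ p ∈ I, f p = 1)
    (hfin : hMeasure C O ≠ ⊤) (hpos : hMeasure C I ≠ 0)
    (hcomp : hMeasure C O ≤ 256 * hMeasure C I) : rayleigh C C f ≤ 256 * b ^ 2 := by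
  set μ := (hMeasure C).restrict C with hμ
  have hμO : μ O = hMeasure C O := by
    rw [hμ, Measure.restrict_apply hO, inter_eq_left.2 hOC]
  have hμI : μ I = hMeasure C I := by
    rw [hμ, Measure.restrict_apply hI, inter_eq_left.2 (hsubset.trans hOC)]
  have hIfin : hMeasure C I ≠ ⊤ := ne_top_of_le_ne_top hfin (measure_mono hsubset)
  have iO : ∀ k : ℝ, Integrable (O.indicator fun _ => k) μ := fun k =>
    (integrable_indicator_iff hO).2 (integrableOn_const (by rw [hμO]; exact hfin))
  have iI : Integrable (I.indicator fun _ => (1:ℝ)) μ :=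
    (integrable_indicator_iff hI).2 (integrableOn_const (by rw [hμI]; exact hIfin))
  have num : ∫ p, dualNorm C p (fderiv ℝ f p) ^ 2 ∂μ ≤ (hMeasure C O).toReal * b ^ 2 := by
    have := integral_mono_of_nonneg (μ := μ) (f := fun p => dualNorm C p (fderiv ℝ f p) ^ 2)
      (Eventually.of_forall fun _ => sq_nonneg _) (iO (b^2)) (Eventually.of_forall fun p => by
        by_cases hp : p ∈ O
        · rw [indicator_of_mem hp]
          exact sq_le_sq' (abs_le.1 (hd p hp)).1 (abs_le.1 (hd p hp)).2
        · rw [indicator_of_notMem hp]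
          show dualNorm C p (fderiv ℝ f p) ^ 2 ≤ 0
          rw [hd0 p hp]; simp)
    refine this.trans (le_of_eq ?_)
    rw [integral_indicator_const _ hO, Measure.real, hμO, smul_eq_mul]
  have if2 : Integrable (fun p => f p ^ 2) μ := by
    refine (iO 1).mono' (hfc.pow 2).aestronglyMeasurable (Eventually.of_forall fun p => ?_)
    by_cases hp : p ∈ O
    · rw [indicator_of_mem hp, Real.norm_eq_abs, abs_pow]
      exact pow_le_one₀ (abs_nonneg _) (hf1 p)
    · rw [indicator_of_notMem hp, hf0 p hp]; simp
  have den : (hMeasure C I).toReal ≤ ∫ p, f p ^ 2 ∂μ := by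
    have := integral_mono iI if2 (fun p => by
      by_cases hp : p ∈ I
      · rw [indicator_of_mem hp]; simp [hfI p hp]
      · rw [indicator_of_notMem hp]; exact sq_nonneg _)
    refine le_trans (le_of_eq ?_) this
    rw [integral_indicator_const _ hI, Measure.real, hμI, smul_eq_mul, mul_one]
  have hIpos : 0 < (hMeasure C I).toReal := ENNReal.toReal_pos hpos hIfin
  have hOI : (hMeasure C O).toReal ≤ 256 * (hMeasure C I).toReal := by
    have := ENNReal.toReal_mono (ENNReal.mul_ne_top (by norm_num) hIfin) hcomp
    simpa [ENNReal.toReal_mul] using this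
  rw [rayleigh, div_le_iff₀ (lt_of_lt_of_le hIpos den)]
  calc _ ≤ (hMeasure C O).toReal * b ^ 2 := num
    _ ≤ (256 * (hMeasure C I).toReal) * b ^ 2 := mul_le_mul_of_nonneg_right hOI (sq_nonneg _)
    _ = 256 * b ^ 2 * (hMeasure C I).toReal := by ring
    _ ≤ _ := mul_le_mul_of_nonneg_left den (by positivity)

lemma dens_bounds {C : Set (Euc 2)} (c : ℝ≥0) (hc : 0 < c) (p : Euc 2) (s h : ℝ)
    (hs : 0 < s) (hh : 0 < h)
    (hb : (c : ℝ) * (s * h) ≤ (volume (tangentBall C p 1)).toReal ∧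
    (volume (tangentBall C p 1)).toReal ≤ 64 * ((c : ℝ) * (s * h))) :
    ENNReal.ofReal ((omegaVol 2 / c / 64) / (s * h)) ≤ dens C p ∧
      dens C p ≤ ENNReal.ofReal ((omegaVol 2 / c) / (s * h)) := by
  have hω := omega_pos
  have hc' : (0:ℝ) < c := hc
  have hp : 0 < (c : ℝ) * (s * h) := by positivity
  constructor
  · apply ENNReal.ofReal_le_ofReal
    have : omegaVol 2 / c / 64 / (s * h) = omegaVol 2 / (64 * ((c : ℝ) * (s * h))) := by
      field_simp
    rw [this]
    exact div_le_div_of_nonneg_left hω.le (lt_of_lt_of_le hp hb.1) hb.2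
  · apply ENNReal.ofReal_le_ofReal
    have : omegaVol 2 / c / (s * h) = omegaVol 2 / ((c : ℝ) * (s * h)) := by
      field_simp
    rw [this]
    exact div_le_div_of_nonneg_left hω.le hp hb.1

lemma log_exp_div (m r : ℝ) : Real.log (Real.exp (m + r) / Real.exp (m - r)) = 2 * r := by
  rw [← Real.exp_sub, Real.log_exp]; ring

lemma lambda_le (C : Set (Euc 2)) (hopen : IsOpen C) (B : Euc 2) (L : (ℝ × ℝ) ≃L[ℝ] Euc 2)
    (h1 : ∀ x : ℝ × ℝ, B + L x ∈ C → 0 < x.2)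
    (h2 : ∀ x : ℝ × ℝ, 0 < x.1 → 0 < x.2 → x.1 + x.2 ≤ 1 → B + L x ∈ C)
    (h3 : ∀ a > 0, ∃ M ≥ 0, ∀ x : ℝ × ℝ, B + L x ∈ C → 0 < x.1 + M * x.2 + a)
    (φ : ℝ → ℝ) (K : ℝ) (hφs : ContDiff ℝ 1 φ) (hφ0 : ∀ x, 1 ≤ |x| → φ x = 0)
    (hφ1 : ∀ x, |x| ≤ 1/2 → φ x = 1) (hφb : ∀ x, |φ x| ≤ 1) (hφK : ∀ x, |deriv φ x| ≤ K)
    (hK : 0 ≤ K) (R : ℝ) (hR : 0 < R) : lambda1 C ≤ 256 * (10 * K / R) ^ 2 := by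
  set m1 : ℝ := -3 - R with hm1
  obtain ⟨M, hM, h3⟩ := h3 (Real.exp (m1 - R)) (Real.exp_pos _)
  set d : ℝ := min (1/4) (Real.exp (m1 - R) / (M + 1)) with hd
  have hd0 : 0 < d := lt_min (by norm_num) (div_pos (Real.exp_pos _) (by linarith))
  set m2 : ℝ := Real.log d - R with hm2
  have e1 : Real.exp (m1 + R) ≤ 1/4 := by
    have : m1 + R = -3 := by rw [hm1]; ring
    rw [this, Real.exp_neg, ← one_div]
    apply one_div_le_one_div_of_le (by norm_num)
    have := Real.add_one_le_exp (3:ℝ)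
    linarith
  have e2 : Real.exp (m2 + R) = d := by
    rw [hm2, sub_add_cancel, Real.exp_log hd0]
  set O' : Set (ℝ × ℝ) := Icc (Real.exp (m1 - R)) (Real.exp (m1 + R)) ×ˢ
    Icc (Real.exp (m2 - R)) (Real.exp (m2 + R)) with hO'
  set I' : Set (ℝ × ℝ) := Icc (Real.exp (m1 - R/2)) (Real.exp (m1 + R/2)) ×ˢ
    Icc (Real.exp (m2 - R/2)) (Real.exp (m2 + R/2)) with hI'
  have hsubset : I' ⊆ O' := by
    apply Set.prod_mono <;> apply Icc_subset_Icc <;> apply Real.exp_le_exp.2 <;> linarith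
  have hOm : MeasurableSet O' := measurableSet_Icc.prod measurableSet_Icc
  have hIm : MeasurableSet I' := measurableSet_Icc.prod measurableSet_Icc
  have hpos : ∀ x ∈ O', 0 < x.1 ∧ 0 < x.2 := fun x hx =>
    ⟨lt_of_lt_of_le (Real.exp_pos _) hx.1.1, lt_of_lt_of_le (Real.exp_pos _) hx.2.1⟩
  have hq : ∀ x ∈ O', x.1 ≤ 1/4 ∧ x.2 ≤ 1/4 := fun x hx =>
    ⟨hx.1.2.trans e1, (hx.2.2.trans e2.le).trans (min_le_left _ _)⟩
  have hOC : ∀ x ∈ O', B + L x ∈ C := fun x hx =>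
    h2 x (hpos x hx).1 (hpos x hx).2 (by linarith [(hq x hx).1, (hq x hx).2])
  have hMx : ∀ x ∈ O', M * x.2 ≤ x.1 := by
    intro x hx
    have k1 : x.2 ≤ Real.exp (m1 - R) / (M + 1) := (hx.2.2.trans e2.le).trans (min_le_right _ _)
    rw [le_div_iff₀ (by linarith)] at k1
    have := hx.1.1
    have := (hpos x hx).2
    nlinarith
  have hout : ∀ x ∈ O', ∀ u : ℝ × ℝ, fNorm C (B + L x) (L u) ≤ 1 →
      |u.1| ≤ 8 * x.1 ∧ |u.2| ≤ 2 * x.2 := fun x hx u hu =>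
    ⟨fN_low1 hopen h1 _ M hM h3 x (hOC x hx) hx.1.1 (hpos x hx).1 (hMx x hx) u hu,
      fN_low2 hopen h1 x (hOC x hx) u hu⟩
  obtain ⟨c, hc, hc1, hc2⟩ := vol_scale L B
  have hdens := fun x hx => dens_bounds (C := C) c hc (B + L x) x.1 x.2 (hpos x hx).1 (hpos x hx).2
    (tb_bounds c (B + L x) x.1 x.2 (hpos x hx).1 (hpos x hx).2 hc1
      (fun u => fN_up h2 x (hpos x hx).1 (hq x hx).1 (hpos x hx).2 (hq x hx).2 u) (hout x hx))
  set κ : ℝ := omegaVol 2 / c with hκ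
  have hκ0 : 0 < κ := div_pos omega_pos hc
  have mO : hMeasure C ((fun x => B + L x) '' O') ≤ c * ENNReal.ofReal (κ * (2 * R * (2 * R))) := by
    rw [hMeasure_image C L B c hc2 O' hOm hOC]
    gcongr
    rw [← log_exp_div m1 R]
    nth_rewrite 2 [log_exp_div m1 R]
    rw [← log_exp_div m2 R, ← lint_box κ _ _ _ _ hκ0.le (Real.exp_pos _)
      (Real.exp_le_exp.2 (by linarith)) (Real.exp_pos _) (Real.exp_le_exp.2 (by linarith))]
    exact setLIntegral_mono' hOm (fun x hx => (hdens x hx).2)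
  have mI : c * ENNReal.ofReal (κ / 64 * (R * R)) ≤ hMeasure C ((fun x => B + L x) '' I') := by
    rw [hMeasure_image C L B c hc2 I' hIm (fun x hx => hOC x (hsubset hx))]
    gcongr
    have e : R * R = (2 * (R/2)) * (2 * (R/2)) := by ring
    rw [e, ← log_exp_div m1 (R/2)]
    nth_rewrite 2 [log_exp_div m1 (R/2)]
    rw [← log_exp_div m2 (R/2), ← lint_box (κ/64) _ _ _ _ (by positivity) (Real.exp_pos _)
      (Real.exp_le_exp.2 (by linarith)) (Real.exp_pos _) (Real.exp_le_exp.2 (by linarith))]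
    exact setLIntegral_mono' hIm (fun x hx => (hdens x (hsubset hx)).1)
  -- the test function
  set π1 : Euc 2 →L[ℝ] ℝ := (ContinuousLinearMap.fst ℝ ℝ ℝ).comp (L.symm : Euc 2 →L[ℝ] ℝ × ℝ) with hπ1
  set π2 : Euc 2 →L[ℝ] ℝ := (ContinuousLinearMap.snd ℝ ℝ ℝ).comp (L.symm : Euc 2 →L[ℝ] ℝ × ℝ) with hπ2
  set f : Euc 2 → ℝ := fun p => eta φ m1 R (π1 (p - B)) * eta φ m2 R (π2 (p - B)) with hf
  have hpr : ∀ p : Euc 2, ∃ x : ℝ × ℝ, p = B + L x := fun p => ⟨L.symm (p - B), by simp⟩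
  have p1 : ∀ x, π1 (B + L x - B) = x.1 := by intro x; simp [hπ1]
  have p2 : ∀ x, π2 (B + L x - B) = x.2 := by intro x; simp [hπ2]
  have q1 : ∀ x, π1 (L x) = x.1 := by intro x; simp [hπ1]
  have q2 : ∀ x, π2 (L x) = x.2 := by intro x; simp [hπ2]
  have c1 : ContDiff ℝ 1 (eta φ m1 R) := eta_contDiff hR hφ0 hφs
  have c2 : ContDiff ℝ 1 (eta φ m2 R) := eta_contDiff hR hφ0 hφs
  have hfs : ContDiff ℝ 1 f := by
    apply ContDiff.mul
    · exact c1.comp (π1.contDiff.comp (contDiff_id.sub contDiff_const))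
    · exact c2.comp (π2.contDiff.comp (contDiff_id.sub contDiff_const))
  have hfd : ∀ x : ℝ × ℝ, fderiv ℝ f (B + L x) =
      eta φ m1 R x.1 • (deriv (eta φ m2 R) x.2 • π2) +
      eta φ m2 R x.2 • (deriv (eta φ m1 R) x.1 • π1) := by
    intro x
    have a1 : HasFDerivAt (fun p => π1 (p - B)) π1 (B + L x) :=
      π1.hasFDerivAt.comp (B + L x) ((hasFDerivAt_id _).sub_const B)
    have a2 : HasFDerivAt (fun p => π2 (p - B)) π2 (B + L x) :=
      π2.hasFDerivAt.comp (B + L x) ((hasFDerivAt_id _).sub_const B)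
    have b1 : HasDerivAt (eta φ m1 R) (deriv (eta φ m1 R) x.1) (π1 (B + L x - B)) := by
      rw [p1]; exact (c1.differentiable (by norm_num) _).hasDerivAt
    have b2 : HasDerivAt (eta φ m2 R) (deriv (eta φ m2 R) x.2) (π2 (B + L x - B)) := by
      rw [p2]; exact (c2.differentiable (by norm_num) _).hasDerivAt
    have := ((b1.comp_hasFDerivAt (B + L x) a1).mul (b2.comp_hasFDerivAt (B + L x) a2)).fderiv
    simp only [Function.comp_apply, p1, p2] at this
    exact this
  have hOcl : IsCompact ((fun x => B + L x) '' O') :=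
    (isCompact_Icc.prod isCompact_Icc).image (by fun_prop)
  have hf0 : ∀ p ∉ (fun x => B + L x) '' O', f p = 0 := by
    intro p hp
    obtain ⟨x, rfl⟩ := hpr p
    have hx : x ∉ O' := fun hx => hp ⟨x, hx, rfl⟩
    show eta φ m1 R (π1 (B + L x - B)) * eta φ m2 R (π2 (B + L x - B)) = 0
    rw [p1, p2]
    by_contra hne
    apply hx
    constructor <;> by_contra hh
    · exact hne (by rw [eta_eq_zero hR hφ0 (fun h => hh (Ioo_subset_Icc_self h)), zero_mul])
    · exact hne (by rw [eta_eq_zero (m := m2) hR hφ0 (fun h => hh (Ioo_subset_Icc_self h)), mul_zero])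
  have hfI : ∀ p ∈ (fun x => B + L x) '' I', f p = 1 := by
    rintro _ ⟨x, hx, rfl⟩
    show eta φ m1 R (π1 (B + L x - B)) * eta φ m2 R (π2 (B + L x - B)) = 1
    rw [p1, p2, eta_one hR hφ1 hx.1, eta_one hR hφ1 hx.2, one_mul]
  have hf1 : ∀ p, |f p| ≤ 1 := by
    intro p
    show |eta φ m1 R (π1 (p - B)) * eta φ m2 R (π2 (p - B))| ≤ 1
    rw [abs_mul]
    exact mul_le_one₀ (eta_abs_le hφb _) (abs_nonneg _) (eta_abs_le hφb _)
  have hb0 : 0 ≤ 10 * K / R := by positivity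
  have hray : rayleigh C C f ≤ 256 * (10 * K / R) ^ 2 := by
    refine rayleigh_le C hopen f hfs.continuous _ _ ((emb L B).measurableSet_image.2 hOm)
      ((emb L B).measurableSet_image.2 hIm) (image_mono hsubset) ?_ _ hb0 ?_ ?_ hf0 hf1 hfI ?_ ?_ ?_
    · rintro _ ⟨x, hx, rfl⟩; exact hOC x hx
    · rintro _ ⟨x, hx, rfl⟩
      apply dualNorm_abs_le hb0
      intro v hv
      obtain ⟨u, rfl⟩ := L.surjective v
      obtain ⟨u1, u2⟩ := hout x hx u hv.le
      obtain ⟨x1, x2⟩ := hpos x hx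
      have d1 := eta_deriv (m := m1) hφs hφK hR x1
      have d2 := eta_deriv (m := m2) hφs hφK hR x2
      have g1 := eta_abs_le (m := m1) (R := R) hφb x.1
      have g2 := eta_abs_le (m := m2) (R := R) hφb x.2
      show |fderiv ℝ f (B + L x) (L u)| ≤ _
      rw [hfd]
      simp only [ContinuousLinearMap.add_apply, ContinuousLinearMap.smul_apply, smul_eq_mul, q1, q2]
      have t2 : |eta φ m1 R x.1 * (deriv (eta φ m2 R) x.2 * u.2)| ≤ 1 * (K / (R * x.2) * (2 * x.2)) := by
        rw [abs_mul, abs_mul]; gcongr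
      have t1 : |eta φ m2 R x.2 * (deriv (eta φ m1 R) x.1 * u.1)| ≤ 1 * (K / (R * x.1) * (8 * x.1)) := by
        rw [abs_mul, abs_mul]; gcongr
      refine (abs_add_le _ _).trans ((add_le_add t2 t1).trans (le_of_eq ?_))
      field_simp; norm_num
    · intro p hp
      have hz : fderiv ℝ f p = 0 := by
        have : f =ᶠ[nhds p] fun _ => 0 := by
          filter_upwards [hOcl.isClosed.isOpen_compl.mem_nhds hp] with q hq using hf0 q hq
        rw [this.fderiv_eq]; simp
      have := dualNorm_abs_le (C := C) (p := p) (l := fderiv ℝ f p) le_rfl (by intro u _; simp [hz])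
      exact abs_nonpos_iff.1 this
    · exact ne_top_of_le_ne_top (ENNReal.mul_ne_top ENNReal.coe_ne_top ENNReal.ofReal_ne_top) mO
    · refine (lt_of_lt_of_le ?_ mI).ne'
      apply ENNReal.mul_pos
      · exact_mod_cast hc.ne'
      · exact (ENNReal.ofReal_pos.2 (by positivity)).ne'
    · refine mO.trans (le_trans (le_of_eq ?_) (mul_le_mul_right mI 256))
      have : κ * (2 * R * (2 * R)) = 256 * (κ / 64 * (R * R)) := by ring
      rw [this, ENNReal.ofReal_mul (by norm_num)]
      have : ENNReal.ofReal 256 = 256 := by norm_num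
      rw [this]; ring
  have hcs : HasCompactSupport f := HasCompactSupport.intro hOcl hf0
  have hmem : f ∈ testFuns C := by
    refine ⟨ContDiff.lipschitzWith_of_hasCompactSupport hcs hfs (by norm_num), ?_, hcs, ?_⟩
    · intro hz
      have : f (B + L (Real.exp m1, Real.exp m2)) = 1 := hfI _ ⟨_, by
        constructor <;> constructor <;> apply Real.exp_le_exp.2 <;> linarith, rfl⟩
      rw [hz] at this
      simp at this
    · have : tsupport f ⊆ (fun x => B + L x) '' O' :=
        closure_minimal (fun p hp => by_contra fun h => hp (hf0 p h)) hOcl.isClosed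
      refine this.trans ?_
      rintro _ ⟨x, hx, rfl⟩; exact hOC x hx
  refine le_trans ?_ hray
  exact csInf_le ⟨0, by rintro _ ⟨g, _, rfl⟩; exact rayleigh_nonneg C g⟩ ⟨f, hmem, rfl⟩

/-- a bounded open convex subset of `ℝ²` with `λ₁(C) > 0` is strictly
convex: the open segment joining two distinct boundary points lies in `C`. -/
theorem stmt4 (C : Set (Euc 2)) (hconv : Convex ℝ C) (hopen : IsOpen C)
    (hbdd : Bornology.IsBounded C) (hne : C.Nonempty)
    (hl : 0 < lambda1 C) :
    ∀ x ∈ frontier C, ∀ y ∈ frontier C, x ≠ y → openSegment ℝ x y ⊆ C := by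
  intro x hx y hy hxy z hz
  by_contra hzC
  obtain ⟨B, L, h1, h2, h3⟩ := exists_coords C hconv hopen hbdd hne x y z hx hy hxy hz hzC
  obtain ⟨φ, K, a1, a2, a3, a4, a5, a6⟩ := exists_phi
  have key := fun R hR => lambda_le C hopen B L h1 h2 h3 φ K a1 a2 a3 a4 a5 a6 R hR
  have hlim : Tendsto (fun R : ℝ => 256 * (10 * K / R) ^ 2) atTop (nhds (256 * 0 ^ 2)) :=
    ((tendsto_const_nhds.div_atTop tendsto_id).pow 2).const_mul 256
  have := ge_of_tendsto hlim ((eventually_gt_atTop 0).mono key)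
  simp at this
  linarith
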